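/- Let λ > 0. For every X, g ∈ ℝ^{n×p}, the landing direction satisfies the exact Pythagorean identity ‖skew(g Xᵀ)X + λX(XᵀX − I_p)‖_F² = ‖skew(g Xᵀ)X‖_F² + λ²‖X(XᵀX − I_p)‖_F². -/

import Mathlib

open Matrix Finset

noncomputable section

/-- Frobenius inner product `⟨A, B⟩ = Tr (Aᵀ * B)`. -/
def finner {n p : ℕ} (A B : Matrix (Fin n) (Fin p) ℝ) : ℝ :=
  (Aᵀ * B).trace

/-- Frobenius norm `‖A‖_F = √(Tr (Aᵀ * A))`. -/
def fnorm {n p : ℕ} (A : Matrix (Fin n) (Fin p) ℝ) : ℝ :=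
  Real.sqrt ((Aᵀ * A).trace)

/-- Skew-symmetric part `skew M = (M - Mᵀ)/2`. -/
def skewPart {m : ℕ} (M : Matrix (Fin m) (Fin m) ℝ) : Matrix (Fin m) (Fin m) ℝ :=
  (1 / 2 : ℝ) • (M - Mᵀ)

/-- Symmetric part `sym M = (M + Mᵀ)/2`. -/
def symPart {m : ℕ} (M : Matrix (Fin m) (Fin m) ℝ) : Matrix (Fin m) (Fin m) ℝ :=
  (1 / 2 : ℝ) • (M + Mᵀ)

/-- Penalty function `N(X) = ‖XᵀX - I‖_F² / 4`. -/
def penaltyN {n p : ℕ} (X : Matrix (Fin n) (Fin p) ℝ) : ℝ :=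
  (1 / 4 : ℝ) * fnorm (Xᵀ * X - 1) ^ 2

/-- Landing direction `Λ̃(X; g) = skew(g Xᵀ) X + λ X (XᵀX - I)` with gradient estimate `g`. -/
def landingDir {n p : ℕ} (lam : ℝ) (X g : Matrix (Fin n) (Fin p) ℝ) :
    Matrix (Fin n) (Fin p) ℝ :=
  skewPart (g * Xᵀ) * X + lam • (X * (Xᵀ * X - 1))

lemma trace_transpose_mul_self_nonneg {n p : ℕ} (A : Matrix (Fin n) (Fin p) ℝ) :
    0 ≤ (Aᵀ * A).trace := by
  simp only [Matrix.trace, Matrix.diag_apply, Matrix.mul_apply, Matrix.transpose_apply]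
  exact Finset.sum_nonneg fun _ _ => Finset.sum_nonneg fun _ _ => mul_self_nonneg _

lemma fnorm_sq {n p : ℕ} (A : Matrix (Fin n) (Fin p) ℝ) : fnorm A ^ 2 = finner A A :=
  Real.sq_sqrt (trace_transpose_mul_self_nonneg A)

lemma finner_comm {n p : ℕ} (A B : Matrix (Fin n) (Fin p) ℝ) : finner A B = finner B A := by
  rw [finner, ← Matrix.trace_transpose, Matrix.transpose_mul, Matrix.transpose_transpose, finner]

lemma fnorm_add_smul_sq {n p : ℕ} (A B : Matrix (Fin n) (Fin p) ℝ) (c : ℝ)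
    (h : finner A B = 0) : fnorm (A + c • B) ^ 2 = fnorm A ^ 2 + c ^ 2 * fnorm B ^ 2 := by
  have h' : finner B A = 0 := finner_comm B A ▸ h
  simp only [fnorm_sq]
  simp only [finner] at h h' ⊢
  simp only [Matrix.transpose_add, Matrix.transpose_smul, Matrix.add_mul, Matrix.mul_add,
    Matrix.smul_mul, Matrix.mul_smul, Matrix.trace_add, Matrix.trace_smul, smul_eq_mul, h, h']
  ring

lemma transpose_skewPart {m : ℕ} (M : Matrix (Fin m) (Fin m) ℝ) :
    (skewPart M)ᵀ = -skewPart M := by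
  rw [skewPart, Matrix.transpose_smul, Matrix.transpose_sub, Matrix.transpose_transpose,
    ← smul_neg, neg_sub]

lemma finner_mul_mul_eq_zero_of_skew_of_symm {n p : ℕ} {W : Matrix (Fin n) (Fin n) ℝ}
    {S : Matrix (Fin p) (Fin p) ℝ} (X : Matrix (Fin n) (Fin p) ℝ) (hW : Wᵀ = -W)
    (hS : Sᵀ = S) : finner (W * X) (X * S) = 0 := by
  have h₁ : finner (W * X) (X * S) = -(Xᵀ * W * X * S).trace := by
    simp [finner, Matrix.transpose_mul, hW, Matrix.mul_assoc]
  have h₂ : finner (X * S) (W * X) = (Xᵀ * W * X * S).trace := by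
    rw [finner, Matrix.transpose_mul, hS, Matrix.mul_assoc, Matrix.trace_mul_comm,
      Matrix.mul_assoc Xᵀ W X]
  have h₃ := finner_comm (W * X) (X * S)
  linarith

/-- exact Pythagorean identity for the landing direction. -/
theorem landing_pythagoras {n p : ℕ} (lam : ℝ) (hlam : 0 < lam)
    (X g : Matrix (Fin n) (Fin p) ℝ) :
    fnorm (skewPart (g * Xᵀ) * X + lam • (X * (Xᵀ * X - 1))) ^ 2 =
      fnorm (skewPart (g * Xᵀ) * X) ^ 2 + lam ^ 2 * fnorm (X * (Xᵀ * X - 1)) ^ 2 :=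
  fnorm_add_smul_sq _ _ _ <|
    finner_mul_mul_eq_zero_of_skew_of_symm X (transpose_skewPart _) (by simp)
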